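/- For all tangent smooth vector fields X, Y, Z, W on D and every x ∈ D, the intrinsic curvature of the family of hyperboloids satisfies η(R_t(X, Y)Z, W)(x) = [η(Y(x), Z(x)) η(X(x), W(x)) − η(X(x), Z(x)) η(Y(x), W(x))] / (2 f(x)); in particular each level set f = c (c ≠ 0) is a surface of constant curvature. -/

import Mathlib

open scoped BigOperators

noncomputable section

/-- `∂ᵢ h`, the `i`-th partial derivative of `h : ℝⁿ → ℝ`. -/
def pd {n : ℕ} (h : (Fin n → ℝ) → ℝ) (i : Fin n) (x : Fin n → ℝ) : ℝ :=
  fderiv ℝ h x (Pi.single i 1)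

/-- The action `X(h) = Σᵢ Xⁱ ∂ᵢ h` of a vector field on a function. -/
def vact {n : ℕ} (X : (Fin n → ℝ) → Fin n → ℝ) (h : (Fin n → ℝ) → ℝ)
    (x : Fin n → ℝ) : ℝ :=
  ∑ i, X x i * pd h i x

/-- The Lie bracket `[X,Y]ʲ = Σᵢ (Xⁱ ∂ᵢYʲ − Yⁱ ∂ᵢXʲ)` of vector fields. -/
def lie {n : ℕ} (X Y : (Fin n → ℝ) → Fin n → ℝ) (x : Fin n → ℝ) : Fin n → ℝ :=
  fun j => ∑ i, (X x i * pd (fun y => Y y j) i x - Y x i * pd (fun y => X y j) i x)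

/-- The flat covariant derivative `(∇_X Y)ʲ = Σᵢ Xⁱ ∂ᵢYʲ`. -/
def nablaFlat {n : ℕ} (X Y : (Fin n → ℝ) → Fin n → ℝ) (x : Fin n → ℝ) :
    Fin n → ℝ :=
  fun j => ∑ i, X x i * pd (fun y => Y y j) i x

/-- `f(x) = ½((x¹)² + (x²)² − (x³)²)` on `ℝ³`. -/
def fH : (Fin 3 → ℝ) → ℝ := fun x => ((x 0) ^ 2 + (x 1) ^ 2 - (x 2) ^ 2) / 2

/-- The Minkowski pairing `η(u,v) = u¹v¹ + u²v² − u³v³` on `ℝ³`. -/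
def etaM (u v : Fin 3 → ℝ) : ℝ := u 0 * v 0 + u 1 * v 1 - u 2 * v 2

/-- The open set `D = {x ∈ ℝ³ | f(x) ≠ 0}`, union of all hyperboloids. -/
def DH : Set (Fin 3 → ℝ) := {x | fH x ≠ 0}

/-- The normal projection `W_⊥ = (W(f)/(2f)) V_⊥`, with `V_⊥` the radial
(position) vector field. -/
def perpH (W : (Fin 3 → ℝ) → Fin 3 → ℝ) (x : Fin 3 → ℝ) : Fin 3 → ℝ :=
  fun i => (vact W fH x / (2 * fH x)) * x i

/-- The tangential projection `W_t = W − W_⊥`. -/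
def tangH (W : (Fin 3 → ℝ) → Fin 3 → ℝ) (x : Fin 3 → ℝ) : Fin 3 → ℝ :=
  fun i => W x i - perpH W x i

/-- The projected Levi-Civita connection `∇_{t,X} Y = (∇_X Y)_t`. -/
def nablaTH (X Y : (Fin 3 → ℝ) → Fin 3 → ℝ) : (Fin 3 → ℝ) → Fin 3 → ℝ :=
  fun x => tangH (nablaFlat X Y) x

/-- The intrinsic curvature
`R_t(X,Y)Z = ∇_{t,X}(∇_{t,Y} Z) − ∇_{t,Y}(∇_{t,X} Z) − ∇_{t,[X,Y]} Z`. -/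
def RtH (X Y Z : (Fin 3 → ℝ) → Fin 3 → ℝ) : (Fin 3 → ℝ) → Fin 3 → ℝ :=
  fun x i => nablaTH X (nablaTH Y Z) x i - nablaTH Y (nablaTH X Z) x i
    - nablaTH (lie X Y) Z x i

theorem vact_eq_fderiv (X : (Fin 3 → ℝ) → Fin 3 → ℝ) (h : (Fin 3 → ℝ) → ℝ) (x : Fin 3 → ℝ) :
    ∑ i, X x i * pd h i x = fderiv ℝ h x (X x) := by
  unfold pd
  conv_rhs => rw [pi_eq_sum_univ' (X x)]
  rw [map_sum]
  refine Finset.sum_congr rfl fun i _ => ?_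
  rw [map_smul, smul_eq_mul]

theorem nablaFlat_eq (X Y : (Fin 3 → ℝ) → Fin 3 → ℝ) (x : Fin 3 → ℝ)
    (hY : DifferentiableAt ℝ Y x) : nablaFlat X Y x = fderiv ℝ Y x (X x) := by
  funext j
  unfold nablaFlat
  have h := (hasFDerivAt_pi'.1 hY.hasFDerivAt) j
  rw [vact_eq_fderiv, h.fderiv]
  rfl

theorem lie_eq (X Y : (Fin 3 → ℝ) → Fin 3 → ℝ) (x : Fin 3 → ℝ)
    (hX : DifferentiableAt ℝ X x) (hY : DifferentiableAt ℝ Y x) :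
    lie X Y x = fderiv ℝ Y x (X x) - fderiv ℝ X x (Y x) := by
  rw [← nablaFlat_eq X Y x hY, ← nablaFlat_eq Y X x hX]
  funext j
  simp only [lie, nablaFlat, Pi.sub_apply, Finset.sum_sub_distrib]

theorem hasFDerivAt_coord (i : Fin 3) (x : Fin 3 → ℝ) :
    HasFDerivAt (fun y : Fin 3 → ℝ => y i)
      (ContinuousLinearMap.proj (R := ℝ) (φ := fun _ : Fin 3 => ℝ) i) x :=
  hasFDerivAt_apply i x

theorem fderiv_etaM (A B : (Fin 3 → ℝ) → Fin 3 → ℝ) (x v : Fin 3 → ℝ)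
    (hA : DifferentiableAt ℝ A x) (hB : DifferentiableAt ℝ B x) :
    DifferentiableAt ℝ (fun y => etaM (A y) (B y)) x ∧
    fderiv ℝ (fun y => etaM (A y) (B y)) x v
      = etaM (fderiv ℝ A x v) (B x) + etaM (A x) (fderiv ℝ B x v) := by
  have hA' : ∀ i, HasFDerivAt (fun y => A y i)
      ((ContinuousLinearMap.proj (R := ℝ) (φ := fun _ : Fin 3 => ℝ) i).comp (fderiv ℝ A x)) x :=
    hasFDerivAt_pi'.1 hA.hasFDerivAt
  have hB' : ∀ i, HasFDerivAt (fun y => B y i)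
      ((ContinuousLinearMap.proj (R := ℝ) (φ := fun _ : Fin 3 => ℝ) i).comp (fderiv ℝ B x)) x :=
    hasFDerivAt_pi'.1 hB.hasFDerivAt
  have h := (((hA' 0).mul (hB' 0)).add ((hA' 1).mul (hB' 1))).sub ((hA' 2).mul (hB' 2))
  have h2 : HasFDerivAt (fun y => etaM (A y) (B y)) _ x := h
  refine ⟨h2.differentiableAt, ?_⟩
  rw [h2.fderiv]
  simp [etaM]
  ring

theorem fH_eq : fH = fun y => etaM y y / 2 := by
  funext y
  simp only [fH, etaM]
  ring

theorem differentiable_fH : Differentiable ℝ fH := by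
  intro x
  rw [fH_eq]
  have h : DifferentiableAt ℝ (fun y : Fin 3 → ℝ => etaM y y) x :=
    (fderiv_etaM id id x 0 differentiableAt_id differentiableAt_id).1
  exact h.mul_const (2:ℝ)⁻¹

theorem vact_fH (X : (Fin 3 → ℝ) → Fin 3 → ℝ) (x : Fin 3 → ℝ) :
    vact X fH x = etaM (X x) x := by
  unfold vact
  rw [vact_eq_fderiv]
  have h := fderiv_etaM id id x (X x) differentiableAt_id differentiableAt_id
  have h1 : HasFDerivAt (fun y => etaM y y / 2) _ x := h.1.hasFDerivAt.mul_const (2:ℝ)⁻¹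
  rw [fH_eq, h1.fderiv, ContinuousLinearMap.smul_apply, h.2]
  simp [etaM]
  ring

theorem isOpen_DH : IsOpen DH :=
  isOpen_ne_fun differentiable_fH.continuous continuous_const

theorem etaM_tangH (V : (Fin 3 → ℝ) → Fin 3 → ℝ) (x w : Fin 3 → ℝ) (h : etaM w x = 0) :
    etaM (tangH V x) w = etaM (V x) w := by
  simp only [tangH, perpH, etaM] at *
  linear_combination (-(vact V fH x / (2 * fH x))) * h

/-- Gauss formula on `D`. -/
theorem nablaTH_eq (Y Z : (Fin 3 → ℝ) → Fin 3 → ℝ) (hZ : ∀ x ∈ DH, DifferentiableAt ℝ Z x)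
    (hZt : ∀ x ∈ DH, etaM (Z x) x = 0) (x : Fin 3 → ℝ) (hx : x ∈ DH) :
    nablaTH Y Z x = fderiv ℝ Z x (Y x) + (etaM (Y x) (Z x) / (2 * fH x)) • x := by
  have h := (fderiv_etaM Z id x (Y x) (hZ x hx) differentiableAt_id).2
  have h0 : (fun y => etaM (Z y) (id y)) =ᶠ[nhds x] fun _ => (0:ℝ) := by
    filter_upwards [isOpen_DH.mem_nhds hx] with y hy using hZt y hy
  rw [h0.fderiv_eq] at h
  simp only [fderiv_fun_const, fderiv_id, Pi.zero_apply, ContinuousLinearMap.zero_apply,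
    id, ContinuousLinearMap.id_apply] at h
  have h3 : etaM (fderiv ℝ Z x (Y x)) x = - etaM (Y x) (Z x) := by
    have : etaM (Z x) (Y x) = etaM (Y x) (Z x) := by simp only [etaM]; ring
    rw [this] at h
    linarith
  funext i
  simp only [nablaTH, tangH, perpH, vact_fH, nablaFlat_eq Y Z x (hZ x hx), h3, Pi.add_apply,
    Pi.smul_apply, smul_eq_mul]
  ring

theorem contDiffAt_of_DH {X : (Fin 3 → ℝ) → Fin 3 → ℝ} (hX : ContDiffOn ℝ (⊤ : ℕ∞) X DH)
    {x : Fin 3 → ℝ} (hx : x ∈ DH) : ContDiffAt ℝ 2 X x :=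
  (hX.contDiffAt (isOpen_DH.mem_nhds hx)).of_le (WithTop.coe_le_coe.2 (le_top : (2 : ℕ∞) ≤ ⊤))

theorem etaM_nabla2 (X Y Z : (Fin 3 → ℝ) → Fin 3 → ℝ)
    (hY : ContDiffOn ℝ (⊤ : ℕ∞) Y DH) (hZ : ContDiffOn ℝ (⊤ : ℕ∞) Z DH)
    (hZt : ∀ x ∈ DH, etaM (Z x) x = 0) (x w : Fin 3 → ℝ) (hx : x ∈ DH)
    (hw : etaM w x = 0) :
    etaM (nablaTH X (nablaTH Y Z) x) w
      = etaM (fderiv ℝ (fderiv ℝ Z) x (X x) (Y x)) w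
        + etaM (fderiv ℝ Z x (fderiv ℝ Y x (X x))) w
        + etaM (Y x) (Z x) / (2 * fH x) * etaM (X x) w := by
  have dY := (contDiffAt_of_DH hY hx).differentiableAt (by norm_num)
  have dZ : ∀ x ∈ DH, DifferentiableAt ℝ Z x := fun x hx =>
    (contDiffAt_of_DH hZ hx).differentiableAt (by norm_num)
  have ddZ : DifferentiableAt ℝ (fderiv ℝ Z) x :=
    ((contDiffAt_of_DH hZ hx).fderiv_right (m := 1) (by norm_num)).differentiableAt (by norm_num)
  have hev : nablaTH Y Z =ᶠ[nhds x]
      fun y => fderiv ℝ Z y (Y y) + (etaM (Y y) (Z y) / (2 * fH y)) • y := by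
    filter_upwards [isOpen_DH.mem_nhds hx] with y hy using nablaTH_eq Y Z dZ hZt y hy
  have dg : DifferentiableAt ℝ (fun y => etaM (Y y) (Z y) / (2 * fH y)) x := by
    have hne : 2 * fH x ≠ 0 := mul_ne_zero two_ne_zero hx
    have h1 := (fderiv_etaM Y Z x 0 dY (dZ x hx)).1
    have h2 : DifferentiableAt ℝ (fun y => 2 * fH y) x := (differentiable_fH x).const_mul 2
    simp only [div_eq_mul_inv]
    exact h1.fun_mul (h2.fun_inv hne)
  have hd := (ddZ.hasFDerivAt.clm_apply dY.hasFDerivAt).add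
    (dg.hasFDerivAt.smul (hasFDerivAt_id x))
  have hd2 := hd.congr_of_eventuallyEq hev
  have e1 : etaM (nablaTH X (nablaTH Y Z) x) w = etaM (nablaFlat X (nablaTH Y Z) x) w :=
    etaM_tangH _ _ _ hw
  rw [e1, nablaFlat_eq _ _ _ hd2.differentiableAt, hd2.fderiv]
  simp only [ContinuousLinearMap.add_apply, ContinuousLinearMap.comp_apply,
    ContinuousLinearMap.flip_apply, ContinuousLinearMap.smul_apply,
    ContinuousLinearMap.smulRight_apply, ContinuousLinearMap.id_apply, id]
  generalize fderiv ℝ (fun y => etaM (Y y) (Z y) / (2 * fH y)) x (X x) = c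
  generalize etaM (Y x) (Z x) / (2 * fH x) = d
  simp only [etaM, Pi.add_apply, Pi.smul_apply, smul_eq_mul] at *
  linear_combination c * hw

/-- For tangent smooth vector fields `X, Y, Z, W` on `D` the intrinsic
curvature of the family of hyperboloids satisfies
`η(R_t(X,Y)Z, W) = [η(Y,Z) η(X,W) − η(X,Z) η(Y,W)] / (2 f)`;
in particular each hyperboloid `f = c ≠ 0` has constant curvature. -/
theorem statement18 (X Y Z W : (Fin 3 → ℝ) → Fin 3 → ℝ)
    (hX : ContDiffOn ℝ (⊤ : ℕ∞) X DH) (hY : ContDiffOn ℝ (⊤ : ℕ∞) Y DH)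
    (hZ : ContDiffOn ℝ (⊤ : ℕ∞) Z DH) (hW : ContDiffOn ℝ (⊤ : ℕ∞) W DH)
    (hXt : ∀ x ∈ DH, vact X fH x = 0) (hYt : ∀ x ∈ DH, vact Y fH x = 0)
    (hZt : ∀ x ∈ DH, vact Z fH x = 0) (hWt : ∀ x ∈ DH, vact W fH x = 0) :
    ∀ x ∈ DH,
      etaM (RtH X Y Z x) (W x)
        = (etaM (Y x) (Z x) * etaM (X x) (W x)
            - etaM (X x) (Z x) * etaM (Y x) (W x)) / (2 * fH x) := by
  intro x hx
  simp only [vact_fH] at hXt hYt hZt hWt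
  have dX := (contDiffAt_of_DH hX hx).differentiableAt (by norm_num)
  have dY := (contDiffAt_of_DH hY hx).differentiableAt (by norm_num)
  have dZ := (contDiffAt_of_DH hZ hx).differentiableAt (by norm_num)
  have hw := hWt x hx
  have a := etaM_nabla2 X Y Z hY hZ hZt x (W x) hx hw
  have b := etaM_nabla2 Y X Z hX hZ hZt x (W x) hx hw
  have c : etaM (nablaTH (lie X Y) Z x) (W x)
      = etaM (fderiv ℝ Z x (fderiv ℝ Y x (X x))) (W x)
        - etaM (fderiv ℝ Z x (fderiv ℝ X x (Y x))) (W x) := by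
    have e1 : etaM (nablaTH (lie X Y) Z x) (W x) = etaM (nablaFlat (lie X Y) Z x) (W x) :=
      etaM_tangH _ _ _ hw
    rw [e1, nablaFlat_eq _ _ _ dZ, lie_eq X Y x dX dY, map_sub]
    simp only [etaM, Pi.sub_apply]
    ring
  have s : fderiv ℝ (fderiv ℝ Z) x (X x) (Y x) = fderiv ℝ (fderiv ℝ Z) x (Y x) (X x) :=
    ((contDiffAt_of_DH hZ hx).isSymmSndFDerivAt (by simp)) (X x) (Y x)
  have e : etaM (RtH X Y Z x) (W x) = etaM (nablaTH X (nablaTH Y Z) x) (W x)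
      - etaM (nablaTH Y (nablaTH X Z) x) (W x) - etaM (nablaTH (lie X Y) Z x) (W x) := by
    simp only [RtH, etaM]
    ring
  rw [e, a, b, c, s]
  ring
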